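/- arXiv:0907.2586 — 4 statements merged into one kernel-verified Lean document; each statement's English description precedes it below -/
import Mathlib

section
/- For every k > 0 and a > 0, the supremum over x in the closed ball B_a (of radius a, centered at the origin in ℝ³) of the quantity ∫_{B_a} e^{−2k|x−y|}/(16π²|x−y|²) dy equals e^{−ka} sinh(ka)/(4πk), and it is attained at x = 0. Equivalently, the constant μ = sup_{x∈B_a} k² ‖G(x,·)‖_{L²(B_a)} satisfies μ = k² e^{−ka/2} (sinh(ka)/(4πk))^{1/2}. -/
open MeasureTheory

noncomputable section

abbrev E3 : Type := EuclideanSpace ℝ (Fin 3)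

/-- The closed ball `B_a` of radius `a` centered at the origin in `ℝ³`. -/
def Ba (a : ℝ) : Set E3 := Metric.closedBall (0 : E3) a

/-- Lebesgue measure restricted to `B_a`. -/
def volB (a : ℝ) : Measure E3 := volume.restrict (Ba a)

/-- The free-space Green's function `G(x,y) = e^{-k|x-y|}/(4π|x-y|)` of `-Δ + k²`. -/
def Gk (k : ℝ) (x y : E3) : ℝ :=
  Real.exp (-k * dist x y) / (4 * Real.pi * dist x y)

/-- `μ = sup_{x ∈ B_a} k² ‖G(x,·)‖_{L²(B_a)}`. -/
def muC (a k : ℝ) : ℝ :=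
  ⨆ x : (Ba a), k ^ 2 * Real.sqrt (∫ y, (Gk k (↑x) y) ^ 2 ∂(volB a))

/-- The integral over a closed ball of a nonnegative radially decreasing function is largest when
the ball is centered at the origin. -/
theorem setIntegral_norm_closedBall_le {E : Type*} [NormedAddCommGroup E] [NormedSpace ℝ E]
    [FiniteDimensional ℝ E] [Nontrivial E] [MeasurableSpace E] [BorelSpace E]
    (μ : Measure E) [μ.IsAddHaarMeasure] {f : ℝ → ℝ} {a : ℝ} (ha : 0 < a)
    (hf : AntitoneOn f (Set.Ioi 0)) (hf0 : ∀ r, 0 ≤ f r)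
    (hfi : IntegrableOn (fun y => f ‖y‖) (Metric.closedBall (0 : E) a) μ) (x : E) :
    ∫ y in Metric.closedBall x a, f ‖y‖ ∂μ ≤ ∫ y in Metric.closedBall (0 : E) a, f ‖y‖ ∂μ := by
  by_cases hx : IntegrableOn (fun y => f ‖y‖) (Metric.closedBall x a) μ
  swap
  · rw [integral_undef hx]
    exact integral_nonneg fun y => hf0 _
  have hc (z : E) : IntegrableOn (fun _ => f a) (Metric.closedBall z a) μ :=
    integrableOn_const (isCompact_closedBall z a).measure_lt_top.ne
  have key : ∫ y in Metric.closedBall x a, (f ‖y‖ - f a) ∂μ ≤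
      ∫ y in Metric.closedBall (0 : E) a, (f ‖y‖ - f a) ∂μ := by
    rw [← integral_indicator Metric.isClosed_closedBall.measurableSet,
      ← integral_indicator Metric.isClosed_closedBall.measurableSet]
    refine integral_mono_ae
      ((hx.sub (hc x)).integrable_indicator Metric.isClosed_closedBall.measurableSet)
      ((hfi.sub (hc 0)).integrable_indicator Metric.isClosed_closedBall.measurableSet) ?_
    have h0 : ∀ᵐ y ∂μ, y ≠ 0 := by simp [ae_iff]
    filter_upwards [h0] with y hy
    have hy' : 0 < ‖y‖ := norm_pos_iff.mpr hy
    by_cases h1 : y ∈ Metric.closedBall (0 : E) a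
    · rw [Set.indicator_of_mem h1]
      have : f a ≤ f ‖y‖ := hf hy' ha (by simpa using h1)
      exact Set.indicator_le' (fun _ _ => le_rfl) (fun _ _ => sub_nonneg.mpr this) y
    · rw [Set.indicator_of_notMem h1]
      have h2 : a < ‖y‖ := by simpa using h1
      have : f ‖y‖ ≤ f a := hf ha hy' h2.le
      exact Set.indicator_apply_le' (fun _ => sub_nonpos.mpr this) (fun _ => le_rfl)
  rw [integral_sub hx (hc x), integral_sub hfi (hc 0)] at key
  simpa [Measure.real, Measure.addHaar_closedBall_center μ x a] using key

/-- The square of the Green's function as a function of the distance. -/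
def greenSq (k r : ℝ) : ℝ := Real.exp (-(2 * k) * r) / (16 * Real.pi ^ 2 * r ^ 2)

theorem greenSq_nonneg (k r : ℝ) : 0 ≤ greenSq k r := by
  unfold greenSq
  positivity

theorem greenSq_antitoneOn {k : ℝ} (hk : 0 < k) : AntitoneOn (greenSq k) (Set.Ioi 0) := by
  intro r hr s hs hrs
  have hr' : 0 < r := hr
  unfold greenSq
  gcongr ?_ / ?_
  · apply Real.exp_le_exp.mpr
    nlinarith
  · gcongr

theorem Gk_sq (k : ℝ) (x y : E3) : Gk k x y ^ 2 = greenSq k (dist x y) := by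
  unfold Gk greenSq
  rw [div_pow, ← Real.exp_nat_mul]
  congr 1
  · congr 1
    push_cast
    ring
  · ring

theorem sq_mul_greenSq_indicator (a k r : ℝ) (hr : r ∈ Set.Ioi 0) :
    r ^ 2 • (Set.Iic a).indicator (greenSq k) r =
      (Set.Iic a).indicator (fun r => (16 * Real.pi ^ 2)⁻¹ * Real.exp (-(2 * k) * r)) r := by
  have hr' : r ≠ 0 := ne_of_gt hr
  by_cases h : r ∈ Set.Iic a
  · rw [Set.indicator_of_mem h, Set.indicator_of_mem h]
    unfold greenSq
    have := Real.pi_ne_zero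
    simp only [smul_eq_mul]
    field_simp
  · simp [Set.indicator_of_notMem h]

theorem indicator_closedBall_norm (f : ℝ → ℝ) (a : ℝ) :
    (Metric.closedBall (0 : E3) a).indicator (fun y => f ‖y‖) =
      fun y => (Set.Iic a).indicator f ‖y‖ := by
  ext y
  simp [Set.indicator]

theorem integrableOn_greenSq_norm (a k : ℝ) :
    IntegrableOn (fun y : E3 => greenSq k ‖y‖) (Metric.closedBall 0 a) := by
  rw [← integrable_indicator_iff Metric.isClosed_closedBall.measurableSet,
    indicator_closedBall_norm, integrable_fun_norm_addHaar]
  simp only [finrank_euclideanSpace_fin, Nat.add_one_sub_one]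
  rw [integrableOn_congr_fun (sq_mul_greenSq_indicator a k) measurableSet_Ioi,
    IntegrableOn, integrable_indicator_iff measurableSet_Iic, IntegrableOn,
    Measure.restrict_restrict measurableSet_Iic, Set.inter_comm, Set.Ioi_inter_Iic]
  exact Continuous.integrableOn_Ioc
    (f := fun r => (16 * Real.pi ^ 2)⁻¹ * Real.exp (-(2 * k) * r)) (by fun_prop)

theorem integral_greenSq_norm {a k : ℝ} (ha : 0 < a) (hk : 0 < k) :
    ∫ y in Metric.closedBall (0 : E3) a, greenSq k ‖y‖ =
      Real.exp (-(k * a)) * Real.sinh (k * a) / (4 * Real.pi * k) := by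
  rw [← integral_indicator Metric.isClosed_closedBall.measurableSet,
    indicator_closedBall_norm, integral_fun_norm_addHaar]
  simp only [finrank_euclideanSpace_fin, Nat.add_one_sub_one]
  rw [setIntegral_congr_fun measurableSet_Ioi (sq_mul_greenSq_indicator a k),
    setIntegral_indicator measurableSet_Iic, Set.Ioi_inter_Iic,
    ← intervalIntegral.integral_of_le ha.le, intervalIntegral.integral_const_mul,
    intervalIntegral.integral_comp_mul_left Real.exp (neg_ne_zero.mpr (by positivity)),
    integral_exp,
    Measure.real, EuclideanSpace.volume_ball_fin_three]
  have hexp : Real.exp (-(2 * k) * a) = Real.exp (-(k * a)) * Real.exp (-(k * a)) := by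
    rw [← Real.exp_add]
    ring_nf
  have hone : Real.exp (-(k * a)) * Real.exp (k * a) = 1 := by
    rw [← Real.exp_add]
    simp
  have hpi := Real.pi_ne_zero
  rw [hexp, Real.sinh_eq, mul_div_assoc', mul_sub, hone]
  simp only [ENNReal.ofReal_one, one_pow, one_mul, mul_zero, Real.exp_zero, smul_eq_mul,
    nsmul_eq_mul, Nat.cast_ofNat]
  rw [ENNReal.toReal_ofReal (by positivity)]
  field_simp
  ring

theorem integral_greenSq_dist (a k : ℝ) (x : E3) :
    ∫ y, greenSq k (dist x y) ∂(volB a) = ∫ y in Metric.closedBall x a, greenSq k ‖y‖ := by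
  unfold volB Ba
  rw [← integral_indicator Metric.isClosed_closedBall.measurableSet,
    ← integral_indicator Metric.isClosed_closedBall.measurableSet,
    ← integral_sub_left_eq_self _ volume x]
  congr 1 with y
  have : y ∈ Metric.closedBall x a ↔ x - y ∈ Metric.closedBall (0 : E3) a := by
    simp [dist_eq_norm, norm_sub_rev]
  simp [Set.indicator, dist_eq_norm, norm_sub_rev]

/-- **The value of the constant `μ`**: for `k, a > 0`,
`sup_{x∈B_a} ∫_{B_a} e^{-2k|x-y|}/(16π²|x-y|²) dy = e^{-ka} sinh(ka)/(4πk)`, the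
supremum being attained at `x = 0`; equivalently,
`μ = k² e^{-ka/2} (sinh(ka)/(4πk))^{1/2}`. -/
theorem mu_value (a k : ℝ) (ha : 0 < a) (hk : 0 < k) :
    (⨆ x : (Ba a),
        ∫ y, Real.exp (-(2 * k) * dist (↑x : E3) y) /
          (16 * Real.pi ^ 2 * dist (↑x : E3) y ^ 2) ∂(volB a)) =
      Real.exp (-(k * a)) * Real.sinh (k * a) / (4 * Real.pi * k) ∧
    (∫ y, Real.exp (-(2 * k) * dist (0 : E3) y) /
        (16 * Real.pi ^ 2 * dist (0 : E3) y ^ 2) ∂(volB a)) =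
      Real.exp (-(k * a)) * Real.sinh (k * a) / (4 * Real.pi * k) ∧
    muC a k = k ^ 2 * Real.exp (-(k * a) / 2) *
      Real.sqrt (Real.sinh (k * a) / (4 * Real.pi * k)) := by
  have hfi := integrableOn_greenSq_norm a k
  have h0 := integral_greenSq_dist a k 0
  rw [integral_greenSq_norm ha hk] at h0
  have hle (x : E3) : ∫ y, greenSq k (dist x y) ∂(volB a) ≤
      ∫ y, greenSq k (dist 0 y) ∂(volB a) := by
    rw [integral_greenSq_dist, integral_greenSq_dist]
    exact setIntegral_norm_closedBall_le volume ha (greenSq_antitoneOn hk) (greenSq_nonneg k) hfi x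
  have hsup {F : E3 → ℝ} (hF : ∀ x, F x ≤ F 0) : ⨆ x : Ba a, F x = F 0 := by
    have hmem : (0 : E3) ∈ Ba a := Metric.mem_closedBall_self ha.le
    have : Nonempty (Ba a) := ⟨⟨0, hmem⟩⟩
    exact le_antisymm (ciSup_le fun x => hF x)
      (le_ciSup (f := fun x : Ba a => F x) ⟨F 0, by rintro _ ⟨x, rfl⟩; exact hF x⟩ ⟨0, hmem⟩)
  refine ⟨(hsup hle).trans h0, h0, ?_⟩
  unfold muC
  simp only [Gk_sq]
  rw [hsup (F := fun x => k ^ 2 * Real.sqrt (∫ y, greenSq k (dist x y) ∂(volB a)))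
    (fun x => by gcongr ?_ * Real.sqrt ?_; exact hle x), h0, mul_div_assoc,
    Real.sqrt_mul (Real.exp_pos _).le, ← Real.exp_half, ← mul_assoc]

end
end

section
/- Let E and F be Banach spaces over a nontrivially normed field 𝕜, let K be a formal multilinear series from E to F with K₀ = 0, and suppose there is a continuous linear map J₁ : F → E such that J₁ ∘ K₁ = id_E (where K₁ is the linear coefficient of K). Then there exists a formal multilinear series 𝒦 from F to E with 𝒦₀ = 0 and linear coefficient 𝒦₁ = J₁ such that the formal composition 𝒦 ∘ K equals the identity formal multilinear series of E; i.e., the coefficients 𝒦_j defined recursively by 𝒦_j(y₁,…,y_j) = −Σ_{m=1}^{j−1} Σ_{i₁+⋯+i_m=j, i_l ≥ 1} 𝒦_m( K_{i₁}(J₁y₁,…,J₁y_{i₁}), …, K_{i_m}(J₁y_{j−i_m+1},…,J₁y_j) ) satisfy 𝒦₁K₁ = I and, for every j ≥ 2, Σ_{m=1}^{j} Σ_{i₁+⋯+i_m=j, i_l ≥ 1} 𝒦_m ∘ (K_{i₁} ⊗ ⋯ ⊗ K_{i_m}) = 0. -/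
open FormalMultilinearSeries

namespace FormalMultilinearSeries

variable {𝕜 : Type*} [NontriviallyNormedField 𝕜]
  {E : Type*} [NormedAddCommGroup E] [NormedSpace 𝕜 E]
  {F : Type*} [NormedAddCommGroup F] [NormedSpace 𝕜 F]

/-- The formal left inverse of `p` built from a continuous linear map `J`, meant to be a left
inverse of the linear coefficient of `p`. This generalizes `FormalMultilinearSeries.leftInv`, which
requires the linear coefficient to be invertible. -/
noncomputable def leftInvOfLeftInverse (p : FormalMultilinearSeries 𝕜 E F) (J : F →L[𝕜] E) (x : E) :
    FormalMultilinearSeries 𝕜 F E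
  | 0 => ContinuousMultilinearMap.uncurry0 𝕜 _ x
  | 1 => (continuousMultilinearCurryFin1 𝕜 F E).symm J
  | n + 2 =>
    -∑ c : { c : Composition (n + 2) // c.length < n + 2 },
        (leftInvOfLeftInverse p J x (c : Composition (n + 2)).length).compAlongComposition
          (p.compContinuousLinearMap J) c

theorem leftInvOfLeftInverse_coeff_zero (p : FormalMultilinearSeries 𝕜 E F) (J : F →L[𝕜] E)
    (x : E) : p.leftInvOfLeftInverse J x 0 = ContinuousMultilinearMap.uncurry0 𝕜 _ x := by
  rw [leftInvOfLeftInverse]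

theorem leftInvOfLeftInverse_coeff_one (p : FormalMultilinearSeries 𝕜 E F) (J : F →L[𝕜] E)
    (x : E) :
    p.leftInvOfLeftInverse J x 1 = (continuousMultilinearCurryFin1 𝕜 F E).symm J := by
  rw [leftInvOfLeftInverse]

/-- If `J` is a left inverse of the linear coefficient of `p`, then `p.leftInvOfLeftInverse J x` is
a left inverse of `p` for the composition of formal multilinear series. -/
theorem leftInvOfLeftInverse_comp (p : FormalMultilinearSeries 𝕜 E F) (J : F →L[𝕜] E) (x : E)
    (h : ∀ y : E, J (p 1 fun _ => y) = y) :
    (p.leftInvOfLeftInverse J x).comp p = id 𝕜 E x := by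
  ext n v
  match n with
  | 0 =>
    simp only [comp_coeff_zero', leftInvOfLeftInverse_coeff_zero,
      ContinuousMultilinearMap.uncurry0_apply, id_apply_zero]
  | 1 =>
    have hv : v = fun _ => v 0 := funext fun j => congrArg v (Subsingleton.elim j 0)
    simp only [comp_coeff_one, leftInvOfLeftInverse_coeff_one, id_apply_one,
      continuousMultilinearCurryFin1_symm_apply]
    rw [hv]
    exact h (v 0)
  | n + 2 =>
    have A :
      (Finset.univ : Finset (Composition (n + 2))) =
        {c | Composition.length c < n + 2}.toFinset ∪ {Composition.ones (n + 2)} := by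
      refine Finset.Subset.antisymm (fun c _ => ?_) (Finset.subset_univ _)
      by_cases! h : c.length < n + 2
      · simp [h]
      · simp [Composition.eq_ones_iff_le_length.2 h]
    have B :
      Disjoint ({c | Composition.length c < n + 2} : Set (Composition (n + 2))).toFinset
        {Composition.ones (n + 2)} := by
      simp
    have C :
      ((p.leftInvOfLeftInverse J x (Composition.ones (n + 2)).length)
          fun j : Fin (Composition.ones n.succ.succ).length =>
          p 1 fun _ => v ((Fin.castLE (Composition.length_le _)) j)) =
        p.leftInvOfLeftInverse J x (n + 2) fun j : Fin (n + 2) => p 1 fun _ => v j := by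
      apply FormalMultilinearSeries.congr _ (Composition.ones_length _) fun j hj1 hj2 => ?_
      exact FormalMultilinearSeries.congr _ rfl fun k _ _ => by congr
    have D :
      (p.leftInvOfLeftInverse J x (n + 2) fun j : Fin (n + 2) => p 1 fun _ => v j) =
        -∑ c ∈ {c : Composition (n + 2) | c.length < n + 2}.toFinset,
            (p.leftInvOfLeftInverse J x c.length) (p.applyComposition c v) := by
      simp only [leftInvOfLeftInverse, _root_.neg_apply, neg_inj, _root_.sum_apply]
      convert!
        (Finset.sum_toFinset_eq_subtype (fun c : Composition (n + 2) => c.length < n + 2)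
              (fun c : Composition (n + 2) =>
                (ContinuousMultilinearMap.compAlongComposition
                    (p.compContinuousLinearMap J) c (p.leftInvOfLeftInverse J x c.length))
                  fun j : Fin (n + 2) => p 1 fun _ : Fin 1 => v j)).symm.trans
          _
      simp only [compContinuousLinearMap_applyComposition,
        ContinuousMultilinearMap.compAlongComposition_apply]
      congr
      ext c
      congr
      ext k
      simp [h]
    simp [FormalMultilinearSeries.comp, A, Finset.sum_union B,
      applyComposition_ones, C, D, -Set.toFinset_ofPred, -Finset.union_singleton]

end FormalMultilinearSeries

/-- **Formal inversion of a multilinear (Born-type) series.**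
If `K` is a formal multilinear series from `E` to `F` with vanishing constant term and
`J₁ : F →L E` is a continuous linear left inverse of the linear coefficient `K₁`, then there
is a formal multilinear series `𝒦` from `F` to `E` with vanishing constant term and linear
coefficient `J₁` whose formal composition with `K` is the identity formal multilinear
series of `E` (whose `n`-th coefficient is the sum over all compositions `(i₁,…,i_m)` of `n`
of `𝒦_m` applied to blocks `K_{i₁},…,K_{i_m}`). -/
theorem formal_inverse_series_exists
    (𝕜 : Type*) [NontriviallyNormedField 𝕜]
    (E F : Type*) [NormedAddCommGroup E] [NormedSpace 𝕜 E] [CompleteSpace E]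
    [NormedAddCommGroup F] [NormedSpace 𝕜 F] [CompleteSpace F]
    (K : FormalMultilinearSeries 𝕜 E F) (hK0 : K 0 = 0)
    (J1 : F →L[𝕜] E) (hJ1 : ∀ x : E, J1 (K 1 fun _ => x) = x) :
    ∃ Q : FormalMultilinearSeries 𝕜 F E,
      Q 0 = 0 ∧ (∀ y : F, Q 1 (fun _ => y) = J1 y) ∧
      Q.comp K = FormalMultilinearSeries.id 𝕜 E 0 := by
  refine ⟨K.leftInvOfLeftInverse J1 0, ?_, fun y => ?_, K.leftInvOfLeftInverse_comp J1 0 hJ1⟩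
  · ext
    simp [leftInvOfLeftInverse_coeff_zero]
  · simp [leftInvOfLeftInverse_coeff_one]
end

section
/- For every a ∈ ℂ with −1 < Re(a) < 0, ∫₀^∞ y^a/(1+y) dy = π/sin((a+1)π), the integral converging absolutely; here y^a denotes the complex power e^{a log y} of the positive real y. -/
open MeasureTheory Set Complex

/-- The image of `(0, 1)` under `x ↦ x / (1 - x)` is `(0, ∞)`. -/
lemma image_div_one_sub_Ioo : (fun x : ℝ => x / (1 - x)) '' Ioo 0 1 = Ioi 0 := by
  ext y
  constructor
  · rintro ⟨x, ⟨h0, h1⟩, rfl⟩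
    exact div_pos h0 (sub_pos.2 h1)
  · intro (hy : 0 < y)
    refine ⟨y / (1 + y), ⟨by positivity, (div_lt_one (by positivity)).2 (by linarith)⟩, ?_⟩
    have : 1 + y ≠ 0 := by positivity
    have h : 1 - y / (1 + y) = 1 / (1 + y) := by field_simp; ring
    simp only [h]
    field_simp

lemma hasDerivAt_div_one_sub {x : ℝ} (hx : x < 1) :
    HasDerivAt (fun x : ℝ => x / (1 - x)) ((1 - x) ^ 2)⁻¹ x := by
  have h := (hasDerivAt_id x).div ((hasDerivAt_id x).const_sub 1) (sub_pos.2 hx).ne'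
  convert! h using 1
  simp

lemma injOn_div_one_sub : InjOn (fun x : ℝ => x / (1 - x)) (Ioo 0 1) := by
  intro x hx y hy h
  have hx' := (sub_pos.2 hx.2).ne'
  have hy' := (sub_pos.2 hy.2).ne'
  simp only [div_eq_div_iff hx' hy'] at h
  linarith

/-- The substitution `y = x / (1 - x)` turns `y ^ a / (1 + y)` into the beta integrand. -/
lemma abs_deriv_smul_cpow_div_one_add (a : ℂ) {x : ℝ} (hx : x ∈ Ioo (0 : ℝ) 1) :
    |((1 - x) ^ 2)⁻¹| •
        (((x / (1 - x) : ℝ) : ℂ) ^ a / (1 + ((x / (1 - x) : ℝ) : ℂ))) =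
      (x : ℂ) ^ (a + 1 - 1) * (1 - (x : ℂ)) ^ (-a - 1) := by
  have hx' : 0 < 1 - x := sub_pos.2 hx.2
  have hc : (1 - (x : ℂ)) ≠ 0 := by exact_mod_cast hx'.ne'
  have hpow : ((x / (1 - x) : ℝ) : ℂ) ^ a = (x : ℂ) ^ a * (1 - (x : ℂ)) ^ (-a) := by
    rw [div_eq_mul_inv, ofReal_mul, mul_cpow_ofReal_nonneg hx.1.le (inv_pos.2 hx').le,
      ofReal_inv, inv_cpow _ _ (arg_ofReal_of_nonneg hx'.le ▸ Real.pi_ne_zero.symm),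
      ← cpow_neg]
    push_cast
    rfl
  have hsum : 1 + ((x / (1 - x) : ℝ) : ℂ) = (1 - (x : ℂ))⁻¹ := by
    push_cast
    field_simp
    ring
  rw [abs_of_nonneg (by positivity), real_smul, hpow, hsum, cpow_sub _ _ hc, cpow_one,
    add_sub_cancel_right]
  push_cast
  field_simp

/-- **A beta-type integral**: for every `a ∈ ℂ` with `-1 < Re a < 0`,
`∫₀^∞ y^a/(1+y) dy = π / sin((a+1)π)`, the integral converging absolutely. -/
theorem integral_cpow_div_one_add (a : ℂ) (ha₁ : -1 < a.re) (ha₂ : a.re < 0) :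
    IntegrableOn (fun y : ℝ => (y : ℂ) ^ a / (1 + (y : ℂ))) (Ioi 0) ∧
    (∫ y in Ioi (0 : ℝ), (y : ℂ) ^ a / (1 + (y : ℂ))) =
      (Real.pi : ℂ) / Complex.sin ((a + 1) * (Real.pi : ℂ)) := by
  have hu : 0 < (a + 1).re := by simp; linarith
  have hv : 0 < (-a).re := by simpa using ha₂
  have hderiv : ∀ x ∈ Ioo (0 : ℝ) 1,
      HasDerivWithinAt (fun x : ℝ => x / (1 - x)) ((1 - x) ^ 2)⁻¹ (Ioo 0 1) x :=
    fun x hx => (hasDerivAt_div_one_sub hx.2).hasDerivWithinAt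
  rw [← image_div_one_sub_Ioo]
  constructor
  · rw [integrableOn_image_iff_integrableOn_abs_deriv_smul measurableSet_Ioo hderiv
        injOn_div_one_sub,
      integrableOn_congr_fun (fun x hx => abs_deriv_smul_cpow_div_one_add a hx) measurableSet_Ioo,
      ← intervalIntegrable_iff_integrableOn_Ioo_of_le zero_le_one]
    exact betaIntegral_convergent hu hv
  · rw [integral_image_eq_integral_abs_deriv_smul measurableSet_Ioo hderiv injOn_div_one_sub,
      setIntegral_congr_fun measurableSet_Ioo
        (fun x hx => abs_deriv_smul_cpow_div_one_add a hx),
      ← integral_Ioc_eq_integral_Ioo, ← intervalIntegral.integral_of_le zero_le_one]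
    change betaIntegral (a + 1) (-a) = _
    have hGamma := Gamma_mul_Gamma_one_sub (a + 1)
    rw [show 1 - (a + 1) = -a by ring] at hGamma
    rw [betaIntegral_eq_Gamma_mul_div _ _ hu hv, hGamma, show a + 1 + -a = 1 by ring,
      Gamma_one, div_one, mul_comm (Real.pi : ℂ)]
end

section
/- For every k ∈ ℂ, the function u(x) = e^{−k‖x‖}/(4π‖x‖) defined on ℝ³ ∖ {0} is smooth and satisfies Δu(x) = k² u(x) for every x ≠ 0; that is, the fundamental solution of the diffusion (modified Helmholtz) equation solves (Δ − k²)u = 0 away from the source (and, taking k = −ik₀ with k₀ real, the function e^{ik₀‖x‖}/(4π‖x‖) satisfies Δu + k₀²u = 0 away from the origin). -/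
open Complex

noncomputable section

/-- Partial derivative of a complex-valued function in the `i`-th coordinate direction. -/
def pd (i : Fin 3) (f : E3 → ℂ) (x : E3) : ℂ :=
  fderiv ℝ f x (EuclideanSpace.single i 1)

/-- The Laplacian of a complex-valued function on `ℝ³`. -/
def lapC (f : E3 → ℂ) (x : E3) : ℂ :=
  ∑ i, pd i (fun y => pd i f y) x

theorem hasFDerivAt_comp_norm {F : Type*} [NormedAddCommGroup F] [NormedSpace ℝ F]
    {E : Type*} [NormedAddCommGroup E] [InnerProductSpace ℝ E] {f : ℝ → F} {f' : F} {x : E}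
    (hx : x ≠ 0) (hf : HasDerivAt f f' ‖x‖) :
    HasFDerivAt (fun y : E => f ‖y‖) ((‖x‖⁻¹ • innerSL ℝ x).smulRight f') x := by
  have hn : HasFDerivAt (fun y : E => ‖y‖) (‖x‖⁻¹ • innerSL ℝ x) x := by
    have h := (hasStrictFDerivAt_norm_sq x).hasFDerivAt.sqrt (by positivity)
    simp only [Real.sqrt_sq (norm_nonneg _)] at h
    convert h using 1
    ext v
    have : ‖x‖ ≠ 0 := norm_ne_zero_iff.mpr hx
    simp
    field_simp
  exact (hf.hasFDerivAt.comp x hn).congr_fderiv (by ext v; simp [mul_smul])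

theorem pd_comp_norm {f : ℝ → ℂ} {f' : ℂ} {x : E3} (hx : x ≠ 0) (hf : HasDerivAt f f' ‖x‖)
    (i : Fin 3) : pd i (fun y => f ‖y‖) x = f' / (‖x‖ : ℂ) * (x i : ℂ) := by
  rw [pd, (hasFDerivAt_comp_norm hx hf).fderiv]
  simp [EuclideanSpace.inner_single_right]
  ring

theorem pd_comp_norm_mul_coord {g : ℝ → ℂ} {g' : ℂ} {x : E3} (hx : x ≠ 0)
    (hg : HasDerivAt g g' ‖x‖) (i : Fin 3) :
    pd i (fun y => g ‖y‖ * (y i : ℂ)) x = g' / (‖x‖ : ℂ) * (x i : ℂ) ^ 2 + g ‖x‖ := by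
  have hc : HasFDerivAt (fun y : E3 => (y i : ℂ))
      (ofRealCLM.comp (EuclideanSpace.proj i : E3 →L[ℝ] ℝ)) x :=
    (ofRealCLM.comp (EuclideanSpace.proj i : E3 →L[ℝ] ℝ)).hasFDerivAt
  rw [pd, ((hasFDerivAt_comp_norm hx hg).fun_mul hc).fderiv]
  simp [EuclideanSpace.inner_single_right]
  ring

/-- The Laplacian of a radial function `f ‖y‖`, where `f' r = r * g r`. -/
theorem lapC_comp_norm {f g : ℝ → ℂ} {g' : ℂ} {x : E3} (hx : x ≠ 0)
    (hf : ∀ r : ℝ, 0 < r → HasDerivAt f (r * g r) r) (hg : HasDerivAt g g' ‖x‖) :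
    lapC (fun y => f ‖y‖) x = ‖x‖ * g' + 3 * g ‖x‖ := by
  have hpd (i : Fin 3) :
      pd i (fun y => pd i (fun z => f ‖z‖) y) x =
        g' / (‖x‖ : ℂ) * (x i : ℂ) ^ 2 + g ‖x‖ := by
    rw [← pd_comp_norm_mul_coord hx hg i, pd, pd]
    congr 1
    apply Filter.EventuallyEq.fderiv_eq
    filter_upwards [isOpen_ne.mem_nhds hx] with y hy
    have : (‖y‖ : ℂ) ≠ 0 := by simpa using hy
    rw [pd_comp_norm hy (hf _ (norm_pos_iff.mpr hy)), mul_div_cancel_left₀ _ this]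
  have hsum : ∑ i, (x i : ℂ) ^ 2 = (‖x‖ : ℂ) ^ 2 := by
    have := EuclideanSpace.real_norm_sq_eq x
    exact_mod_cast this.symm
  have : (‖x‖ : ℂ) ≠ 0 := by simpa using hx
  simp only [lapC, hpd, Finset.sum_add_distrib, ← Finset.mul_sum, hsum]
  simp
  field_simp

theorem hasDerivAt_cexp_mul_ofReal (c : ℂ) (r : ℝ) :
    HasDerivAt (fun r : ℝ => Complex.exp (c * r)) (Complex.exp (c * r) * c) r := by
  simpa using ((hasDerivAt_id (r : ℂ)).const_mul c).cexp.comp_ofReal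

/-- The outgoing and incoming fundamental solutions satisfy `Δu = c² u` away from the origin. -/
theorem lapC_exp_norm_div_norm (c : ℂ) {x : E3} (hx : x ≠ 0) :
    lapC (fun y : E3 => Complex.exp (c * (‖y‖ : ℂ)) / (4 * (Real.pi : ℂ) * (‖y‖ : ℂ))) x =
      c ^ 2 * (Complex.exp (c * (‖x‖ : ℂ)) / (4 * (Real.pi : ℂ) * (‖x‖ : ℂ))) := by
  have hπ : (Real.pi : ℂ) ≠ 0 := by exact_mod_cast Real.pi_ne_zero
  have hr : (‖x‖ : ℂ) ≠ 0 := by simpa using hx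
  have hid (r : ℝ) : HasDerivAt (fun r : ℝ => (r : ℂ)) 1 r := (hasDerivAt_id r).ofReal_comp
  have hf (r : ℝ) (h : 0 < r) :
      HasDerivAt (fun r : ℝ => Complex.exp (c * r) / (4 * (Real.pi : ℂ) * r))
        (r * (Complex.exp (c * r) * (c * r - 1) / (4 * (Real.pi : ℂ) * r ^ 3))) r := by
    have h0 : (r : ℂ) ≠ 0 := by exact_mod_cast h.ne'
    refine ((hasDerivAt_cexp_mul_ofReal c r).fun_div ((hid r).const_mul (4 * (Real.pi : ℂ)))
      (by simp [hπ, h0])).congr_deriv ?_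
    field_simp
  have hg := ((hasDerivAt_cexp_mul_ofReal c ‖x‖).fun_mul
    (((hid ‖x‖).const_mul c).sub_const 1)).fun_div
    (((hid ‖x‖).fun_pow 3).const_mul (4 * (Real.pi : ℂ))) (by simp [hπ, hx])
  rw [lapC_comp_norm hx hf hg]
  field_simp
  push_cast
  ring

/-- **The fundamental solution of the modified Helmholtz (diffusion) equation**: for every
`k ∈ ℂ`, the function `u(x) = e^{-k‖x‖}/(4π‖x‖)` is smooth away from the origin and
satisfies `Δu = k² u` there; taking `k = -i k₀` with `k₀` real, `e^{i k₀‖x‖}/(4π‖x‖)`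
satisfies `Δu + k₀² u = 0` away from the origin. -/
theorem fundamental_solution_diffusion (k : ℂ) :
    ContDiffOn ℝ (⊤ : ℕ∞) (fun x : E3 => Complex.exp (-k * (‖x‖ : ℂ)) / (4 * (Real.pi : ℂ) * (‖x‖ : ℂ)))
      {x : E3 | x ≠ 0} ∧
    (∀ x : E3, x ≠ 0 →
      lapC (fun y : E3 => Complex.exp (-k * (‖y‖ : ℂ)) / (4 * (Real.pi : ℂ) * (‖y‖ : ℂ))) x =
        k ^ 2 * (Complex.exp (-k * (‖x‖ : ℂ)) / (4 * (Real.pi : ℂ) * (‖x‖ : ℂ)))) ∧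
    ∀ k₀ : ℝ, ∀ x : E3, x ≠ 0 →
      lapC (fun y : E3 =>
          Complex.exp (Complex.I * (k₀ : ℂ) * (‖y‖ : ℂ)) / (4 * (Real.pi : ℂ) * (‖y‖ : ℂ))) x +
        (k₀ : ℂ) ^ 2 *
          (Complex.exp (Complex.I * (k₀ : ℂ) * (‖x‖ : ℂ)) / (4 * (Real.pi : ℂ) * (‖x‖ : ℂ)))
        = 0 := by
  refine ⟨fun x hx => ContDiffAt.contDiffWithinAt ?_, fun x hx => ?_, fun k₀ x hx => ?_⟩
  · have hn : ContDiffAt ℝ (⊤ : ℕ∞) (fun y : E3 => (‖y‖ : ℂ)) x :=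
      ofRealCLM.contDiff.contDiffAt.comp x (contDiffAt_norm ℝ hx)
    have hd : (4 * (Real.pi : ℂ) * (‖x‖ : ℂ)) ≠ 0 := by simpa [Real.pi_ne_zero] using hx
    simp only [div_eq_mul_inv]
    exact (contDiffAt_const.mul hn).cexp.mul ((contDiffAt_const.mul hn).inv hd)
  · rw [lapC_exp_norm_div_norm _ hx, neg_sq]
  · rw [lapC_exp_norm_div_norm _ hx, mul_pow, I_sq]
    ring

end
end
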